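/- Under Assumptions B, C and D, let (u_n) be integers with u_n ∼ n P(H > γM_n), set w_n := n − u_n, v_n := [n^{1−β} u_n^β] − u_n, and let F̄_n(x) := P(H > x | H ≤ γM_n). Then for every 0 < T < ∞, lim_{n→∞} √v_n · sup_{0 ≤ s ≤ T} | (w_n/v_n) F̄_n( s^{−1/α} b(w_n/v_n) ) − s | = 0. -/

import Mathlib

open MeasureTheory ProbabilityTheory Filter Topology Set Asymptotics

noncomputable section

variable {Ω : Type*} [MeasureSpace Ω]

/-- The `k`-th largest order statistic (1-indexed) of the finite sample `f`,
so `orderStat f 1 ≥ orderStat f 2 ≥ … ≥ orderStat f n`. -/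
def orderStat {n : ℕ} (f : Fin n → ℝ) (k : ℕ) : ℝ :=
  if h : n - k < n then f (Tuple.sort f ⟨n - k, h⟩) else 0

/-- The Hill statistic `h(k,n) = (1/k) ∑_{i=1}^k log (X_{(i)} / X_{(k)})`. -/
def hill {n : ℕ} (f : Fin n → ℝ) (k : ℕ) : ℝ :=
  (k : ℝ)⁻¹ * ∑ i ∈ Finset.Icc 1 k, Real.log (orderStat f i / orderStat f k)

/-- Tail probability `x ↦ P(Z > x)`. -/
def tailP (Z : Ω → ℝ) (x : ℝ) : ℝ := (ℙ {ω | Z ω > x}).toReal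

/-- `b(y) := inf {x : 1/P(H > x) ≥ y}`. -/
def bq (Z : Ω → ℝ) (y : ℝ) : ℝ := sInf {x : ℝ | 1 / tailP Z x ≥ y}

/-- `l(x) := x^α P(H > x)`. -/
def ell (α : ℝ) (Z : Ω → ℝ) (x : ℝ) : ℝ := x ^ α * tailP Z x

/-- The tail of `H` is regularly varying with index `-α`. -/
def RegVarTail (H0 : Ω → ℝ) (α : ℝ) : Prop :=
  ∀ x : ℝ, 0 < x → Tendsto (fun t => tailP H0 (t * x) / tailP H0 t) atTop (𝓝 (x ^ (-α)))

/-- A function is regularly varying (at infinity) with index `σ`. -/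
def RegVarFun (A : ℝ → ℝ) (σ : ℝ) : Prop :=
  ∀ x : ℝ, 0 < x → Tendsto (fun t => A (t * x) / A t) atTop (𝓝 (x ^ σ))

/-- Assumption A: there is a sequence `(ε_n)` with
`P(H > M_n)^{-(1-β)} ε_n → 0`, `n P(H > M_n) P(L > ε_n M_n) → 0` and
`P(H > M_n)^{-(1-β)} (l(γ M_n (1+ε_n))/l(γ M_n) - 1) → 0`. -/
def AssumpA (H0 L0 : Ω → ℝ) (M : ℕ → ℝ) (α β γ : ℝ) : Prop :=
  ∃ ε : ℕ → ℝ,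
    Tendsto (fun n : ℕ => tailP H0 (M n) ^ (-(1 - β)) * ε n) atTop (𝓝 0) ∧
    Tendsto (fun n : ℕ => (n : ℝ) * tailP H0 (M n) * tailP L0 (ε n * M n)) atTop (𝓝 0) ∧
    Tendsto (fun n : ℕ => tailP H0 (M n) ^ (-(1 - β)) *
      (ell α H0 (γ * M n * (1 + ε n)) / ell α H0 (γ * M n) - 1)) atTop (𝓝 0)

/-- Assumption B: `n P(H > M_n) → ∞`. -/
def AssumpB (H0 : Ω → ℝ) (M : ℕ → ℝ) : Prop :=
  Tendsto (fun n : ℕ => (n : ℝ) * tailP H0 (M n)) atTop atTop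

/-- Assumption C: `n P(H > M_n)^{2-β} (log M_n)² → 0`. -/
def AssumpC (H0 : Ω → ℝ) (M : ℕ → ℝ) (β : ℝ) : Prop :=
  Tendsto (fun n : ℕ => (n : ℝ) * tailP H0 (M n) ^ (2 - β) * Real.log (M n) ^ 2) atTop (𝓝 0)

/-- Assumption D: for any sequence `(v_n)` with `v_n ∼ n P(H > γ M_n)^β`,
`√v_n [(n/v_n) P(H > b(n/v_n) y^{-1/α}) - y] → 0` uniformly on compact subsets of `[0,∞)`
(with the convention that `P(H > b(n/v_n) · 0^{-1/α}) = P(H > ∞) = 0` at `y = 0`). -/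
def AssumpD (H0 : Ω → ℝ) (M : ℕ → ℝ) (α β γ : ℝ) : Prop :=
  ∀ v : ℕ → ℝ,
    Tendsto (fun n : ℕ => v n / ((n : ℝ) * tailP H0 (γ * M n) ^ β)) atTop (𝓝 1) →
    ∀ K : Set ℝ, K ⊆ Ici 0 → IsCompact K →
      TendstoUniformlyOn
        (fun (n : ℕ) (y : ℝ) => Real.sqrt (v n) *
          (((n : ℝ) / v n) *
              (if y = 0 then 0 else tailP H0 (bq H0 ((n : ℝ) / v n) * y ^ (-α⁻¹))) - y))
        0 atTop K

/-- Assumption E: for any sequence `(v_n)` with `v_n ∼ n P(H > γ M_n)^β`,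
`lim_{T→∞} limsup_n √v_n ∫_T^∞ |(n/v_n) P(H > b(n/v_n) s) - s^{-α}| ds/s = 0`. -/
def AssumpE (H0 : Ω → ℝ) (M : ℕ → ℝ) (α β γ : ℝ) : Prop :=
  ∀ v : ℕ → ℝ,
    Tendsto (fun n : ℕ => v n / ((n : ℝ) * tailP H0 (γ * M n) ^ β)) atTop (𝓝 1) →
    Tendsto (fun T : ℝ =>
        Filter.limsup (fun n : ℕ => Real.sqrt (v n) *
          ∫ s in Ioi T,
            |((n : ℝ) / v n) * tailP H0 (bq H0 ((n : ℝ) / v n) * s) - s ^ (-α)| / s) atTop)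
      atTop (𝓝 0)

/-- `w_n := n - u_n`. -/
def wseq (u : ℕ → ℕ) (n : ℕ) : ℕ := n - u n

/-- `v_n := ⌊n^{1-β} u_n^β⌋ - u_n`. -/
def vseq (u : ℕ → ℕ) (β : ℝ) (n : ℕ) : ℕ :=
  ⌊(n : ℝ) ^ (1 - β) * (u n : ℝ) ^ β⌋₊ - u n

/-- The conditional tail `F̄_n(x) = P(H > x | H ≤ γ M_n)`. -/
def condTail (H0 : Ω → ℝ) (c : ℝ) (x : ℝ) : ℝ :=
  ((ℙ : Measure Ω)[|{ω | H0 ω ≤ c}] {ω | H0 ω > x}).toReal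

lemma tailP_nonneg (Z : Ω → ℝ) (x : ℝ) : 0 ≤ tailP Z x := ENNReal.toReal_nonneg

section TailProbability

variable [IsProbabilityMeasure (ℙ : Measure Ω)]

lemma tailP_le_one (Z : Ω → ℝ) (x : ℝ) : tailP Z x ≤ 1 := measureReal_le_one

lemma tailP_antitone (Z : Ω → ℝ) : Antitone (tailP Z) := fun _ _ h =>
  measureReal_mono (fun _ hω => lt_of_le_of_lt h hω)

lemma measureReal_le_eq_one_sub_tailP {Z : Ω → ℝ} (hZ : Measurable Z) (x : ℝ) :
    (ℙ : Measure Ω).real {ω | Z ω ≤ x} = 1 - tailP Z x := by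
  have hc : {ω | Z ω ≤ x} = {ω | Z ω > x}ᶜ := by ext ω; simp
  rw [hc, probReal_compl_eq_one_sub (measurableSet_lt measurable_const hZ)]
  rfl

lemma tendsto_tailP_atTop {Z : Ω → ℝ} (hZ : Measurable Z) :
    Tendsto (tailP Z) atTop (𝓝 0) := by
  have : IsProbabilityMeasure ((ℙ : Measure Ω).map Z) :=
    Measure.isProbabilityMeasure_map hZ.aemeasurable
  have h := (tendsto_cdf_atTop ((ℙ : Measure Ω).map Z)).const_sub 1
  rw [sub_self] at h
  refine h.congr fun x => ?_
  rw [cdf_eq_real, map_measureReal_apply hZ measurableSet_Iic]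
  have := measureReal_le_eq_one_sub_tailP hZ x
  change 1 - (ℙ : Measure Ω).real {ω | Z ω ≤ x} = _
  linarith

/-- Conditioning on `Z ≤ c` perturbs the tail of `Z` by at most `P(Z > c) / P(Z ≤ c)`. -/
lemma abs_condTail_sub_tailP_le {Z : Ω → ℝ} (hZ : Measurable Z) {c : ℝ}
    (hc : tailP Z c < 1) (x : ℝ) :
    |condTail Z c x - tailP Z x| ≤ tailP Z c / (1 - tailP Z c) := by
  have hpos : 0 < 1 - tailP Z c := sub_pos.2 hc
  set q := (ℙ : Measure Ω).real ({ω | Z ω ≤ c} ∩ {ω | Z ω > x}) with hq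
  have hcond : condTail Z c x = q / (1 - tailP Z c) := by
    rw [← measureReal_le_eq_one_sub_tailP hZ c, hq, div_eq_inv_mul]
    rw [condTail, cond_apply (measurableSet_le hZ measurable_const), ENNReal.toReal_mul,
      ENNReal.toReal_inv]
    rfl
  have hq0 : 0 ≤ q := measureReal_nonneg
  have hqx : q ≤ tailP Z x := measureReal_mono inter_subset_right
  have hxq : tailP Z x ≤ q + tailP Z c := by
    refine (measureReal_mono (μ := (ℙ : Measure Ω)) fun ω hω => ?_).trans
      (measureReal_union_le ({ω | Z ω ≤ c} ∩ {ω | Z ω > x}) {ω | Z ω > c})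
    rcases le_or_gt (Z ω) c with h | h
    · exact Or.inl ⟨h, hω⟩
    · exact Or.inr h
  have h0 := tailP_nonneg Z c
  have hx0 := tailP_nonneg Z x
  have hx1 := tailP_le_one Z x
  rw [hcond, abs_le, ← sub_nonneg, ← sub_nonneg (b := _ - _)]
  constructor
  · have : q / (1 - tailP Z c) - tailP Z x - -(tailP Z c / (1 - tailP Z c)) =
        (q + tailP Z c - tailP Z x + tailP Z x * tailP Z c) / (1 - tailP Z c) := by
      field_simp; ring
    rw [this]
    exact div_nonneg (by nlinarith) hpos.le
  · have : tailP Z c / (1 - tailP Z c) - (q / (1 - tailP Z c) - tailP Z x) =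
        (tailP Z x - q + tailP Z c * (1 - tailP Z x)) / (1 - tailP Z c) := by
      field_simp; ring
    rw [this]
    exact div_nonneg (by nlinarith) hpos.le

end TailProbability

section SampleSizes

variable {u : ℕ → ℕ} {p : ℕ → ℝ} {β : ℝ}

lemma natCast_tsub_eq_max (a b : ℕ) : ((a - b : ℕ) : ℝ) = max ((a : ℝ) - b) 0 := by
  rcases le_total b a with h | h
  · rw [Nat.cast_sub h, max_eq_left (sub_nonneg.2 (Nat.cast_le.2 h))]
  · rw [Nat.sub_eq_zero_of_le h, Nat.cast_zero,
      max_eq_right (sub_nonpos.2 (Nat.cast_le.2 h))]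

lemma tendsto_wseq_div (hp : Tendsto p atTop (𝓝 0)) (hp0 : ∀ᶠ n in atTop, 0 < p n)
    (hu : Tendsto (fun n : ℕ => (u n : ℝ) / ((n : ℝ) * p n)) atTop (𝓝 1)) :
    Tendsto (fun n : ℕ => (wseq u n : ℝ) / n) atTop (𝓝 1) := by
  have h : Tendsto (fun n : ℕ => max (1 - (u n : ℝ) / (n * p n) * p n) 0) atTop (𝓝 1) := by
    simpa using ((hu.mul hp).const_sub 1).max (tendsto_const_nhds (x := (0 : ℝ)))
  refine h.congr' ?_
  filter_upwards [hp0, eventually_gt_atTop 0] with n hpn hn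
  have hn' : (0 : ℝ) < n := Nat.cast_pos.2 hn
  rw [wseq, natCast_tsub_eq_max, ← max_div_div_right hn'.le, zero_div]
  congr 1
  field_simp

lemma tendsto_vseq_div (hβ : β ∈ Ioo (0 : ℝ) 1) (hp : Tendsto p atTop (𝓝 0))
    (hp0 : ∀ᶠ n in atTop, 0 < p n) (hnp : Tendsto (fun n : ℕ => (n : ℝ) * p n) atTop atTop)
    (hu : Tendsto (fun n : ℕ => (u n : ℝ) / ((n : ℝ) * p n)) atTop (𝓝 1)) :
    Tendsto (fun n : ℕ => (vseq u β n : ℝ) / ((n : ℝ) * p n ^ β)) atTop (𝓝 1) := by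
  have hlarge : Tendsto (fun n : ℕ => (n : ℝ) * p n ^ β) atTop atTop := by
    refine tendsto_atTop_mono' _ ?_ hnp
    filter_upwards [hp0, hp.eventually (eventually_lt_nhds one_pos)] with n h0 h1
    gcongr
    exact Real.self_le_rpow_of_le_one h0.le h1.le hβ.2.le
  have hmain : Tendsto (fun n : ℕ => (n : ℝ) ^ (1 - β) * (u n : ℝ) ^ β / ((n : ℝ) * p n ^ β))
      atTop (𝓝 1) := by
    have h := hu.rpow_const (p := β) (Or.inl one_ne_zero)
    rw [Real.one_rpow] at h
    refine h.congr' ?_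
    filter_upwards [hp0, eventually_gt_atTop 0] with n hpn hn
    have hn' : (0 : ℝ) < n := Nat.cast_pos.2 hn
    rw [Real.div_rpow (Nat.cast_nonneg _) (by positivity), Real.mul_rpow hn'.le hpn.le,
      Real.rpow_sub hn', Real.rpow_one]
    field_simp
  have hfloor : Tendsto (fun n : ℕ =>
      (⌊(n : ℝ) ^ (1 - β) * (u n : ℝ) ^ β⌋₊ : ℝ) / ((n : ℝ) * p n ^ β)) atTop (𝓝 1) := by
    have hlow := hmain.sub hlarge.inv_tendsto_atTop
    rw [sub_zero] at hlow
    refine tendsto_of_tendsto_of_tendsto_of_le_of_le' hlow hmain ?_ ?_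
    · filter_upwards [hlarge.eventually_gt_atTop 0] with n hn
      rw [Pi.inv_apply, ← one_div, ← sub_div]
      gcongr
      exact (Nat.sub_one_lt_floor _).le
    · filter_upwards [hlarge.eventually_gt_atTop 0] with n hn
      gcongr
      exact Nat.floor_le (by positivity)
  have hsmall : Tendsto (fun n : ℕ => (u n : ℝ) / ((n : ℝ) * p n ^ β)) atTop (𝓝 0) := by
    have h1 := hp.rpow_const (p := 1 - β) (Or.inr (by linarith [hβ.2]))
    rw [Real.zero_rpow (by linarith [hβ.2])] at h1
    have h := hu.mul h1
    rw [mul_zero] at h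
    refine h.congr' ?_
    filter_upwards [hp0, eventually_gt_atTop 0] with n hpn hn
    have hn' : (0 : ℝ) < n := Nat.cast_pos.2 hn
    rw [Real.rpow_sub hpn, Real.rpow_one]
    field_simp
  have h : Tendsto (fun n : ℕ => max ((⌊(n : ℝ) ^ (1 - β) * (u n : ℝ) ^ β⌋₊ : ℝ) /
      ((n : ℝ) * p n ^ β) - (u n : ℝ) / ((n : ℝ) * p n ^ β)) 0) atTop (𝓝 1) := by
    simpa using (hfloor.sub hsmall).max (tendsto_const_nhds (x := (0 : ℝ)))
  refine h.congr' ?_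
  filter_upwards [hlarge.eventually_gt_atTop 0] with n hn
  rw [vseq, natCast_tsub_eq_max, ← max_div_div_right hn.le, zero_div, sub_div]

end SampleSizes

/-- Assumption C controls `n P(H > γ M_n)^{2-β}` as well. -/
lemma tendsto_mul_tailP_rpow [IsProbabilityMeasure (ℙ : Measure Ω)] {H0 : Ω → ℝ} {M : ℕ → ℝ}
    {α β γ : ℝ} (hγ : 0 < γ) (hreg : RegVarTail H0 α) (hMtop : Tendsto M atTop atTop)
    (hpos : ∀ᶠ n in atTop, 0 < tailP H0 (M n)) (hC : AssumpC H0 M β) :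
    Tendsto (fun n : ℕ => (n : ℝ) * tailP H0 (γ * M n) ^ (2 - β)) atTop (𝓝 0) := by
  have h1 : Tendsto (fun n : ℕ => (n : ℝ) * tailP H0 (M n) ^ (2 - β)) atTop (𝓝 0) := by
    refine squeeze_zero' (.of_forall fun n => ?_) ?_ hC
    · have := tailP_nonneg H0 (M n)
      positivity
    · filter_upwards [(Real.tendsto_log_atTop.comp hMtop).eventually_ge_atTop 1] with n hn
      have := tailP_nonneg H0 (M n)
      exact le_mul_of_one_le_right (by positivity) (one_le_pow₀ hn)
  have h2 := ((hreg γ hγ).comp hMtop).rpow_const (p := 2 - β)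
    (Or.inl (Real.rpow_pos_of_pos hγ _).ne')
  have h := h1.mul h2
  rw [zero_mul] at h
  refine h.congr' ?_
  filter_upwards [hpos] with n hn
  have := Real.rpow_pos_of_pos hn (2 - β)
  rw [Function.comp_apply, mul_comm (M n), Real.div_rpow (tailP_nonneg _ _) hn.le]
  field_simp

/-- Under Assumptions B, C and D, for every `0 < T < ∞`,
`√v_n sup_{0 ≤ s ≤ T} |(w_n/v_n) F̄_n(s^{-1/α} b(w_n/v_n)) - s| → 0`
(with the convention `F̄_n(0^{-1/α} b) = F̄_n(∞) = 0`). -/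
theorem conditional_tail_uniform_convergence
    {Ω : Type*} [MeasureSpace Ω] [IsProbabilityMeasure (ℙ : Measure Ω)]
    (H0 : Ω → ℝ) (hH0meas : Measurable H0) (hH0nn : ∀ ω, 0 ≤ H0 ω)
    (α β γ : ℝ) (hα : 0 < α) (hβ : β ∈ Ioo (0:ℝ) 1) (hγ : γ ∈ Ioo (0:ℝ) 1)
    (hreg : RegVarTail H0 α)
    (M : ℕ → ℝ) (hMpos : ∀ n, 0 < M n) (hMtop : Tendsto M atTop atTop)
    (hB : AssumpB H0 M) (hC : AssumpC H0 M β) (hD : AssumpD H0 M α β γ)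
    (u : ℕ → ℕ)
    (hu : Tendsto (fun n : ℕ => (u n : ℝ) / ((n : ℝ) * tailP H0 (γ * M n))) atTop (𝓝 1))
 :
    ∀ T : ℝ, 0 < T →
      Tendsto
        (fun n : ℕ => Real.sqrt (vseq u β n) *
          ⨆ s : Icc (0:ℝ) T,
            |((wseq u n : ℝ) / (vseq u β n : ℝ)) *
                (if (s : ℝ) = 0 then 0
                 else condTail H0 (γ * M n)
                   ((s : ℝ) ^ (-α⁻¹) * bq H0 ((wseq u n : ℝ) / (vseq u β n : ℝ)))) -
              (s : ℝ)|)
        atTop (𝓝 0) := by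
  intro T hT
  have hβ1 := hβ.2
  set p : ℕ → ℝ := fun n => tailP H0 (γ * M n) with hp_def
  have hpM : ∀ n, tailP H0 (M n) ≤ p n := fun n =>
    tailP_antitone H0 (mul_le_of_le_one_left (hMpos n).le hγ.2.le)
  have htpos : ∀ᶠ n in atTop, 0 < tailP H0 (M n) := by
    filter_upwards [hB.eventually_gt_atTop 0] with n hn
    exact pos_of_mul_pos_right hn (Nat.cast_nonneg n)
  have hp0 : ∀ᶠ n in atTop, 0 < p n := htpos.mono fun n hn => hn.trans_le (hpM n)
  have hp : Tendsto p atTop (𝓝 0) :=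
    (tendsto_tailP_atTop hH0meas).comp (hMtop.const_mul_atTop hγ.1)
  have hnp : Tendsto (fun n : ℕ => (n : ℝ) * p n) atTop atTop :=
    tendsto_atTop_mono (fun n => mul_le_mul_of_nonneg_left (hpM n) (Nat.cast_nonneg n)) hB
  have hw := tendsto_wseq_div hp hp0 hu
  have hv := tendsto_vseq_div hβ hp hp0 hnp hu
  have hwpos : ∀ᶠ n in atTop, 0 < (wseq u n : ℝ) := by
    filter_upwards [hw.eventually (eventually_gt_nhds one_pos)] with n hn
    by_contra h
    have h' : (wseq u n : ℝ) = 0 := le_antisymm (not_lt.1 h) (Nat.cast_nonneg _)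
    simp [h'] at hn
  have hvpos : ∀ᶠ n in atTop, 0 < (vseq u β n : ℝ) := by
    filter_upwards [hv.eventually (eventually_gt_nhds one_pos)] with n hn
    by_contra h
    have h' : (vseq u β n : ℝ) = 0 := le_antisymm (not_lt.1 h) (Nat.cast_nonneg _)
    simp [h'] at hn
  have hwn : ∀ n, (wseq u n : ℝ) ≤ n := fun n => Nat.cast_le.2 (Nat.sub_le _ _)
  have hD' := hD (fun n => (n : ℝ) * vseq u β n / wseq u n) (by
    have h := hv.div hw one_ne_zero
    rw [div_one] at h
    refine h.congr' ?_
    filter_upwards [hwpos, hp0, eventually_gt_atTop 0] with n hwn hpn hn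
    have hn' : (0 : ℝ) < n := Nat.cast_pos.2 hn
    have := Real.rpow_pos_of_pos hpn β
    simp only [Pi.div_apply]
    change _ = (n : ℝ) * vseq u β n / wseq u n / (n * p n ^ β)
    field_simp) (Icc 0 T) (fun x hx => hx.1) isCompact_Icc
  have herr : Tendsto (fun n : ℕ => √(vseq u β n : ℝ) *
      ((wseq u n : ℝ) / vseq u β n * (p n / (1 - p n)))) atTop (𝓝 0) := by
    have h1 := ((tendsto_mul_tailP_rpow hγ.1 hreg hMtop htpos hC).div hv one_ne_zero).sqrt
    rw [zero_div, Real.sqrt_zero] at h1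
    have h2 := (hw.mul h1).div (hp.const_sub 1) (by norm_num)
    rw [mul_zero, zero_div] at h2
    refine h2.congr' ?_
    filter_upwards [hvpos, hp0, eventually_gt_atTop 0] with n hvn hpn hn
    have hn' : (0 : ℝ) < n := Nat.cast_pos.2 hn
    have hb := Real.rpow_pos_of_pos hpn β
    have hsq : (n : ℝ) * p n ^ (2 - β) / (vseq u β n / (n * p n ^ β)) =
        (n * p n) ^ 2 / vseq u β n := by
      rw [Real.rpow_sub hpn, Real.rpow_two]
      field_simp
    have hs : (0 : ℝ) < √(vseq u β n : ℝ) := Real.sqrt_pos.2 hvn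
    simp only [Pi.div_apply]
    change (wseq u n : ℝ) / n * √((n : ℝ) * p n ^ (2 - β) / (vseq u β n / (n * p n ^ β))) /
      (1 - p n) = _
    rw [hsq, Real.sqrt_div (sq_nonneg _), Real.sqrt_sq (by positivity)]
    nth_rw 3 [← Real.sq_sqrt hvn.le]
    field_simp
  rw [Metric.tendstoUniformlyOn_iff] at hD'
  rw [Metric.tendsto_nhds]
  intro ε hε
  filter_upwards [hD' (ε / 4) (by positivity),
    herr.eventually (eventually_lt_nhds (show 0 < ε / 4 by positivity)), hwpos, hvpos,
    eventually_gt_atTop 0, hp.eventually (eventually_lt_nhds one_pos)]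
    with n hDn hen hw0 hv0 hn hp1
  have hn' : (0 : ℝ) < n := Nat.cast_pos.2 hn
  have hratio : (n : ℝ) / (n * vseq u β n / wseq u n) = wseq u n / vseq u β n := by
    field_simp
  have hvle : (vseq u β n : ℝ) ≤ n * vseq u β n / wseq u n := by
    rw [le_div_iff₀ hw0, mul_comm]
    exact mul_le_mul_of_nonneg_right (hwn n) hv0.le
  rw [Real.dist_eq, sub_zero, Real.mul_iSup_of_nonneg (Real.sqrt_nonneg _),
    abs_of_nonneg (Real.iSup_nonneg fun s => by positivity)]
  refine lt_of_le_of_lt (Real.iSup_le (fun s => ?_) (by positivity)) (half_lt_self hε)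
  have hs := hDn s s.2
  rw [hratio, Pi.zero_apply, dist_zero_left, Real.norm_eq_abs, abs_mul,
    abs_of_nonneg (Real.sqrt_nonneg _), mul_comm (bq _ _)] at hs
  set r : ℝ := (wseq u n : ℝ) / vseq u β n
  have hr : 0 ≤ r := by positivity
  set x : ℝ := (s : ℝ) ^ (-α⁻¹) * bq H0 r
  have hdiff : |(if (s : ℝ) = 0 then 0 else condTail H0 (γ * M n) x) -
      (if (s : ℝ) = 0 then 0 else tailP H0 x)| ≤ p n / (1 - p n) := by
    split_ifs
    · rw [sub_self, abs_zero]
      exact div_nonneg (tailP_nonneg _ _) (sub_pos.2 hp1).le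
    · exact abs_condTail_sub_tailP_le hH0meas hp1 x
  generalize (if (s : ℝ) = 0 then 0 else condTail H0 (γ * M n) x) = a at hdiff ⊢
  generalize (if (s : ℝ) = 0 then 0 else tailP H0 x) = b at hdiff hs
  calc √(vseq u β n : ℝ) * |r * a - s|
      ≤ √(vseq u β n : ℝ) * (|r * b - s| + r * |a - b|) := by
        gcongr
        have : r * a - s = (r * b - s) + r * (a - b) := by ring
        rw [this]
        exact (abs_add_le _ _).trans_eq (by rw [abs_mul, abs_of_nonneg hr])
    _ ≤ √((n : ℝ) * vseq u β n / wseq u n) * |r * b - s| +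
        √(vseq u β n : ℝ) * (r * (p n / (1 - p n))) := by
        rw [mul_add]
        gcongr
    _ ≤ ε / 2 := by linarith
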